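/- Let n ≥ 3, α ∈ [2,n), σ < α and 1 < p < (n + α − 2σ)/(n − α). Suppose u is a positive radially decreasing function, continuous on ℝⁿ and continuously differentiable on ℝⁿ∖{0}, such that for every x ∈ ℝⁿ the integral ∫_{ℝⁿ} u(y)^p |x−y|^{α−n} |y|^{−σ} dy is finite and u(x) = ∫_{ℝⁿ} u(y)^p |x−y|^{α−n} |y|^{−σ} dy. Then the integrals ∫_{ℝⁿ} u(x)^{p+1} |x|^{−σ} dx and ∫_{ℝⁿ} u(x)^p |x|^{−σ} |x·∇u(x)| dx are both finite. -/

import Mathlib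

open MeasureTheory RealInnerProductSpace

noncomputable section

/-- `w : ℝⁿ → ℝ` is radially decreasing if `w(x) = W(‖x‖)` for some
nonincreasing `W : [0,∞) → (0,∞)`. -/
def RadiallyDecreasing {n : ℕ} (w : EuclideanSpace ℝ (Fin n) → ℝ) : Prop :=
  ∃ W : ℝ → ℝ, AntitoneOn W (Set.Ici 0) ∧ (∀ r, 0 ≤ r → 0 < W r) ∧
    ∀ x, w x = W ‖x‖

section Auxiliary

open Set Filter Topology

variable {V : ℝ → ℝ} {s q γ C : ℝ}

lemma integrableOn_Ioi_rpow_mul_rpow_of_decay (hV : Continuous V) (hpos : ∀ r, 0 < V r)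
    (hanti : AntitoneOn V (Ici 0)) (hs : 0 < s) (hq : 0 < q)
    (hdecay : ∀ r, 0 < r → V r ≤ C * r ^ (-γ)) (hγ : s < γ * q) :
    IntegrableOn (fun r => r ^ (s - 1) * V r ^ q) (Ioi 0) := by
  have hC : 0 < C := by simpa using (hpos 1).trans_le (hdecay 1 one_pos)
  have hmeas : Measurable fun r => r ^ (s - 1) * V r ^ q := by
    have := hV.measurable
    fun_prop
  rw [← Ioc_union_Ioi_eq_Ioi zero_le_one]
  refine IntegrableOn.union ?_ ?_
  · have hint : IntegrableOn (fun r : ℝ => r ^ (s - 1) * V 0 ^ q) (Ioc 0 1) := by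
      rw [← intervalIntegrable_iff_integrableOn_Ioc_of_le zero_le_one]
      exact (intervalIntegral.intervalIntegrable_rpow' (by linarith)).mul_const _
    refine hint.mono' hmeas.aestronglyMeasurable
      (ae_restrict_of_forall_mem measurableSet_Ioc fun r hr => ?_)
    have hr0 : 0 < r := hr.1
    have h := hpos r
    rw [Real.norm_of_nonneg (by positivity)]
    gcongr
    exact hanti self_mem_Ici hr0.le hr0.le
  · have hint : IntegrableOn (fun r : ℝ => C ^ q * r ^ (s - 1 - γ * q)) (Ioi 1) :=
      (integrableOn_Ioi_rpow_of_lt (by linarith) one_pos).const_mul _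
    refine hint.mono' hmeas.aestronglyMeasurable
      (ae_restrict_of_forall_mem measurableSet_Ioi fun r hr => ?_)
    have hr0 : 0 < r := one_pos.trans hr
    have h := hpos r
    rw [Real.norm_of_nonneg (by positivity)]
    calc r ^ (s - 1) * V r ^ q ≤ r ^ (s - 1) * (C * r ^ (-γ)) ^ q := by
          gcongr
          exact hdecay r hr0
      _ = C ^ q * r ^ (s - 1 - γ * q) := by
          rw [Real.mul_rpow hC.le (by positivity), ← Real.rpow_mul hr0.le, sub_eq_add_neg (s - 1),
            Real.rpow_add hr0, neg_mul]
          ring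

lemma integrableOn_Ioi_rpow_mul_rpow_mul_abs_deriv_of_decay (hV : Continuous V)
    (hpos : ∀ r, 0 < V r) (hanti : AntitoneOn V (Ici 0))
    (hdiff : ∀ r, 0 < r → DifferentiableAt ℝ V r) (hs : 0 < s) (hq : 0 < q)
    (hdecay : ∀ r, 0 < r → V r ≤ C * r ^ (-γ)) (hγ : s < γ * q) :
    IntegrableOn (fun r => r ^ s * V r ^ (q - 1) * |deriv V r|) (Ioi 0) := by
  have hC : 0 < C := by simpa using (hpos 1).trans_le (hdecay 1 one_pos)
  have hint := integrableOn_Ioi_rpow_mul_rpow_of_decay hV hpos hanti hs hq hdecay hγ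
  set f : ℝ → ℝ := fun r => r ^ (s - 1) * V r ^ q
  have hfmeas : Measurable f := by
    have := hV.measurable
    fun_prop
  have hfint (r : ℝ) (hr : 0 ≤ r) : IntervalIntegrable f volume 0 r := by
    rw [intervalIntegrable_iff_integrableOn_Ioc_of_le hr]
    exact hint.mono_set Ioc_subset_Ioi_self
  have hcont : ContinuousWithinAt
      (fun r => s * (∫ t in (0 : ℝ)..r, f t) - r ^ s * V r ^ q) (Ici 0) 0 := by
    refine ContinuousWithinAt.sub (ContinuousWithinAt.const_mul ?_ _) ?_
    · have h := intervalIntegral.continuousOn_primitive_interval (a := 0) (b := 1)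
        (μ := volume) (f := f) (by
          rw [uIcc_of_le zero_le_one, integrableOn_Icc_iff_integrableOn_Ioc]
          exact hint.mono_set Ioc_subset_Ioi_self)
      rw [uIcc_of_le zero_le_one] at h
      exact (h 0 (by simp)).mono_of_mem_nhdsWithin (Icc_mem_nhdsGE one_pos)
    · exact ((Real.continuousAt_rpow_const _ _ (.inr hs.le)).mul
        (hV.continuousAt.rpow_const (.inr hq.le))).continuousWithinAt
  have hderiv (r : ℝ) (hr : r ∈ Ioi (0 : ℝ)) : HasDerivAt
      (fun r => s * (∫ t in (0 : ℝ)..r, f t) - r ^ s * V r ^ q)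
      (q * (r ^ s * V r ^ (q - 1) * |deriv V r|)) r := by
    have hr0 : 0 < r := hr
    have hVr : deriv V r ≤ 0 := by
      have := (hanti.mono Ioi_subset_Ici_self).derivWithin_nonpos (x := r)
      rwa [derivWithin_of_isOpen isOpen_Ioi hr] at this
    have hfc : ContinuousAt f r := (Real.continuousAt_rpow_const _ _ (.inl hr0.ne')).mul
      (hV.continuousAt.rpow_const (.inr hq.le))
    have h1 := (intervalIntegral.integral_hasDerivAt_right (hfint r hr0.le)
      hfmeas.stronglyMeasurable.stronglyMeasurableAtFilter hfc).const_mul s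
    have h2 := (Real.hasDerivAt_rpow_const (p := s) (.inl hr0.ne')).mul
      ((hdiff r hr0).hasDerivAt.rpow_const (p := q) (.inl (hpos r).ne'))
    refine (h1.sub h2).congr_deriv ?_
    rw [abs_of_nonpos hVr]
    ring
  have hlim : Tendsto (fun r => s * (∫ t in (0 : ℝ)..r, f t) - r ^ s * V r ^ q) atTop
      (𝓝 (s * (∫ t in Ioi 0, f t) - 0)) := by
    refine ((intervalIntegral_tendsto_integral_Ioi 0 hint tendsto_id).const_mul s).sub ?_
    have h0 : Tendsto (fun r : ℝ => C ^ q * r ^ (-(γ * q - s))) atTop (𝓝 0) := by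
      simpa using (tendsto_rpow_neg_atTop (sub_pos.2 hγ)).const_mul (C ^ q)
    refine squeeze_zero' ?_ ?_ h0
    · filter_upwards [eventually_gt_atTop 0] with r hr
      have := hpos r
      positivity
    · filter_upwards [eventually_gt_atTop 0] with r hr
      have := hpos r
      calc r ^ s * V r ^ q ≤ r ^ s * (C * r ^ (-γ)) ^ q := by
            gcongr
            exact hdecay r hr
        _ = C ^ q * r ^ (-(γ * q - s)) := by
            rw [Real.mul_rpow hC.le (by positivity), ← Real.rpow_mul hr.le, neg_sub,
              sub_eq_add_neg s, Real.rpow_add hr, neg_mul]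
            ring
  have h := integrableOn_Ioi_deriv_of_nonneg hcont hderiv (fun r hr => by
    have h0 : 0 < r := hr
    have := hpos r
    positivity) hlim
  simpa [IntegrableOn, hq.ne'] using h.const_mul q⁻¹

end Auxiliary

lemma inner_gradient_eq_norm_mul_deriv {E : Type*} [NormedAddCommGroup E] [InnerProductSpace ℝ E]
    [CompleteSpace E] {u : E → ℝ} {V : ℝ → ℝ} (hu : ∀ x, u x = V ‖x‖) {x : E}
    (hx : x ≠ 0) (hdiff : DifferentiableAt ℝ u x) :
    ⟪x, gradient u x⟫ = ‖x‖ * deriv V ‖x‖ := by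
  have hx0 : 0 < ‖x‖ := norm_pos_iff.2 hx
  have hline : HasDerivAt (fun r : ℝ => r • (‖x‖⁻¹ • x)) (‖x‖⁻¹ • x) ‖x‖ := by
    simpa using (hasDerivAt_id ‖x‖).smul_const (‖x‖⁻¹ • x)
  have hcomp : HasDerivAt (fun r : ℝ => u (r • (‖x‖⁻¹ • x))) (fderiv ℝ u x (‖x‖⁻¹ • x)) ‖x‖ := by
    refine HasFDerivAt.comp_hasDerivAt _ ?_ hline
    simpa [smul_smul, hx0.ne'] using hdiff.hasFDerivAt
  have hV : HasDerivAt V (fderiv ℝ u x (‖x‖⁻¹ • x)) ‖x‖ := by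
    refine hcomp.congr_of_eventuallyEq ?_
    filter_upwards [lt_mem_nhds hx0] with r hr
    rw [hu, norm_smul, norm_smul, norm_inv, norm_norm, inv_mul_cancel₀ hx0.ne', mul_one,
      Real.norm_of_nonneg hr.le]
  rw [hV.deriv, inner_gradient_right]
  simp [hx0.ne']

lemma exists_decay_of_integral_equation {n : ℕ} (hn : 0 < n) {α σ p : ℝ} (hαn : α < n)
    (hσ : σ < n) (hp1 : 1 < p) {u : EuclideanSpace ℝ (Fin n) → ℝ} {V : ℝ → ℝ}
    (hu : ∀ x, u x = V ‖x‖) (hpos : ∀ r, 0 < V r) (hanti : AntitoneOn V (Set.Ici 0))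
    (hsol : ∀ x : EuclideanSpace ℝ (Fin n),
      Integrable (fun y => u y ^ p * ‖x - y‖ ^ (α - (n : ℝ)) * ‖y‖ ^ (-σ)) ∧
      u x = ∫ y, u y ^ p * ‖x - y‖ ^ (α - (n : ℝ)) * ‖y‖ ^ (-σ)) :
    ∃ C : ℝ, ∀ r, 0 < r → V r ≤ C * r ^ (-((α - σ) / (p - 1))) := by
  have : Nonempty (Fin n) := ⟨⟨0, hn⟩⟩
  have hn0 : (0 : ℝ) < n := by exact_mod_cast hn
  obtain ⟨K, hK, hball⟩ : ∃ K : ℝ, 0 < K ∧ ∀ r : ℝ, 0 < r →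
      ∫ y : EuclideanSpace ℝ (Fin n), (Set.Iio r).indicator (fun t => t ^ (-σ)) ‖y‖
        = K * r ^ (n - σ) := by
    have hvol : 0 < volume.real (Metric.ball (0 : EuclideanSpace ℝ (Fin n)) 1) :=
      ENNReal.toReal_pos (Metric.measure_ball_pos _ _ one_pos).ne' measure_ball_lt_top.ne
    have hnσ : 0 < n - σ := by linarith
    refine ⟨n * volume.real (Metric.ball (0 : EuclideanSpace ℝ (Fin n)) 1) / (n - σ),
      by positivity, fun r hr => ?_⟩
    rw [integral_fun_norm_addHaar volume ((Set.Iio r).indicator fun t => t ^ (-σ))]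
    have hrad : ∫ y in Set.Ioi (0 : ℝ), y ^ (n - 1) • (Set.Iio r).indicator (fun t => t ^ (-σ)) y
        = r ^ (n - σ) / (n - σ) := by
      calc _ = ∫ y in Set.Ioi (0 : ℝ), (Set.Iio r).indicator (fun t => t ^ (n - 1 - σ)) y := by
            refine setIntegral_congr_fun measurableSet_Ioi fun y hy => ?_
            have hy0 : 0 < y := hy
            by_cases hyr : y ∈ Set.Iio r
            · simp only [Set.indicator_of_mem hyr, smul_eq_mul]
              rw [← Real.rpow_natCast, ← Real.rpow_add hy0, Nat.cast_sub hn]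
              simp [sub_eq_add_neg]
            · simp [Set.indicator_of_notMem hyr]
        _ = ∫ y in (0 : ℝ)..r, y ^ (n - 1 - σ) := by
            rw [setIntegral_indicator measurableSet_Iio, Set.Ioi_inter_Iio,
              intervalIntegral.integral_of_le hr.le, integral_Ioc_eq_integral_Ioo]
        _ = r ^ (n - σ) / (n - σ) := by
            rw [integral_rpow (.inl (by linarith))]
            have he : (n : ℝ) - 1 - σ + 1 = n - σ := by ring
            rw [he, Real.zero_rpow hnσ.ne', sub_zero]
    rw [finrank_euclideanSpace_fin, hrad]
    simp only [smul_eq_mul, nsmul_eq_mul]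
    ring
  refine ⟨(2 ^ (n - α) / K) ^ (p - 1)⁻¹, fun r hr => ?_⟩
  have hVr := hpos r
  set x : EuclideanSpace ℝ (Fin n) := EuclideanSpace.single ⟨0, hn⟩ r with hx
  have hxr : ‖x‖ = r := by simp [hx, abs_of_pos hr]
  have hlower : V r ^ p * (2 * r) ^ (α - n) * (K * r ^ (n - σ)) ≤ V r := by
    obtain ⟨hint, heq⟩ := hsol x
    rw [hu, hxr] at heq
    conv_rhs => rw [heq]
    rw [← hball r hr, ← integral_const_mul]
    refine integral_mono_of_nonneg (.of_forall fun y => ?_) hint (.of_forall fun y => ?_)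
    · refine mul_nonneg (by positivity) ?_
      rw [Set.indicator_apply]
      split_ifs <;> positivity
    · have huy : 0 < u y := by rw [hu]; exact hpos _
      by_cases hyr : ‖y‖ < r
      · have hxy : 0 < ‖x - y‖ := by
          rw [norm_sub_pos_iff]
          rintro rfl
          exact hyr.ne hxr
        have hxy2 : ‖x - y‖ ≤ 2 * r := by linarith [norm_sub_le x y]
        have hVy : V r ≤ u y := by
          rw [hu]
          exact hanti (norm_nonneg y) hr.le hyr.le
        have hker : (2 * r) ^ (α - n) ≤ ‖x - y‖ ^ (α - n) :=
          Real.rpow_le_rpow_of_nonpos hxy hxy2 (by linarith)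
        simp only [Set.indicator_of_mem (Set.mem_Iio.2 hyr)]
        gcongr
      · simp only [Set.indicator_of_notMem (Set.notMem_Iio.2 (not_lt.1 hyr)), mul_zero]
        positivity
  have hp0 : 0 < p - 1 := by linarith
  have hpow : V r ^ (p - 1) ≤ 2 ^ (n - α) / K * r ^ (-(α - σ)) := by
    have h1 : V r ^ p = V r ^ (p - 1) * V r := by
      rw [← Real.rpow_add_one hVr.ne']; simp
    have h2 : (2 * r) ^ (α - n) * (K * r ^ (n - σ)) = (2 ^ (n - α) / K * r ^ (-(α - σ)))⁻¹ := by
      rw [Real.mul_rpow zero_le_two hr.le, mul_inv, ← Real.rpow_neg hr.le, inv_div,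
        div_eq_mul_inv, ← Real.rpow_neg zero_le_two]
      have he : -(-(α - σ)) = (α - n) + (n - σ) := by ring
      rw [he, Real.rpow_add hr, neg_sub]
      ring
    rw [mul_assoc, h1, h2, ← div_eq_mul_inv, div_le_iff₀ (by positivity)] at hlower
    exact le_of_mul_le_mul_right (by linarith) hVr
  calc V r = (V r ^ (p - 1)) ^ (p - 1)⁻¹ := (Real.rpow_rpow_inv hVr.le hp0.ne').symm
    _ ≤ (2 ^ (n - α) / K * r ^ (-(α - σ))) ^ (p - 1)⁻¹ := by gcongr
    _ = _ := by
      rw [Real.mul_rpow (by positivity) (by positivity), ← Real.rpow_mul hr.le, neg_mul,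
        ← div_eq_mul_inv]

theorem stmt_10 (n : ℕ) (hn : 3 ≤ n) (α σ p : ℝ)
    (hα2 : 2 ≤ α) (hαn : α < n) (hσ : σ < α)
    (hp1 : 1 < p) (hp : p < ((n : ℝ) + α - 2 * σ) / ((n : ℝ) - α))
    (u : EuclideanSpace ℝ (Fin n) → ℝ)
    (hupos : ∀ x, 0 < u x) (hurad : RadiallyDecreasing u) (hucont : Continuous u)
    (huC1 : ContDiffOn ℝ 1 u {(0 : EuclideanSpace ℝ (Fin n))}ᶜ)
    (hsol : ∀ x : EuclideanSpace ℝ (Fin n),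
      Integrable (fun y => u y ^ p * ‖x - y‖ ^ (α - (n : ℝ)) * ‖y‖ ^ (-σ)) ∧
      u x = ∫ y, u y ^ p * ‖x - y‖ ^ (α - (n : ℝ)) * ‖y‖ ^ (-σ)) :
    Integrable (fun x : EuclideanSpace ℝ (Fin n) => u x ^ (p + 1) * ‖x‖ ^ (-σ)) ∧
    Integrable (fun x : EuclideanSpace ℝ (Fin n) =>
      u x ^ p * ‖x‖ ^ (-σ) * |⟪x, gradient u x⟫|) := by
  have hn0 : 0 < n := by omega
  have hσn : σ < n := hσ.trans hαn
  have : Nonempty (Fin n) := ⟨⟨0, hn0⟩⟩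
  obtain ⟨W, hWanti, -, hW⟩ := hurad
  set e : EuclideanSpace ℝ (Fin n) := EuclideanSpace.single ⟨0, hn0⟩ 1 with he
  have hnorm : ‖e‖ = 1 := by simp [he]
  set V : ℝ → ℝ := fun r => u (r • e) with hVdef
  have hVW (r : ℝ) (hr : 0 ≤ r) : V r = W r := by
    simp [hVdef, hW, norm_smul, hnorm, abs_of_nonneg hr]
  have hu (x : EuclideanSpace ℝ (Fin n)) : u x = V ‖x‖ := by
    rw [hVW _ (norm_nonneg x), hW]
  have hV : Continuous V := by fun_prop
  have hpos (r : ℝ) : 0 < V r := hupos _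
  have hanti : AntitoneOn V (Set.Ici 0) := hWanti.congr fun r hr => (hVW r hr).symm
  have hudiff (x : EuclideanSpace ℝ (Fin n)) (hx : x ≠ 0) : DifferentiableAt ℝ u x :=
    (huC1.differentiableOn one_ne_zero).differentiableAt
      (isOpen_compl_singleton.mem_nhds hx)
  have hVdiff (r : ℝ) (hr : 0 < r) : DifferentiableAt ℝ V r := by
    have hre : r • e ≠ 0 := smul_ne_zero hr.ne' (norm_ne_zero_iff.1 (by simp [hnorm]))
    exact (hudiff _ hre).comp r (by fun_prop)
  obtain ⟨C, hdecay⟩ := exists_decay_of_integral_equation hn0 hαn hσn hp1 hu hpos hanti hsol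
  have hs : 0 < n - σ := by linarith
  have hq : 0 < p + 1 := by linarith
  have hγ : n - σ < (α - σ) / (p - 1) * (p + 1) := by
    rw [lt_div_iff₀ (by linarith)] at hp
    rw [div_mul_eq_mul_div, lt_div_iff₀ (by linarith)]
    nlinarith
  have hpow (r : ℝ) (hr : 0 < r) : r ^ (n - 1) * r ^ (-σ) = r ^ (n - σ - 1) := by
    rw [← Real.rpow_natCast, ← Real.rpow_add hr, Nat.cast_sub hn0]
    congr 1
    push_cast
    ring
  constructor
  · simp only [hu]
    rw [integrable_fun_norm_addHaar volume (f := fun r => V r ^ (p + 1) * r ^ (-σ)),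
      finrank_euclideanSpace_fin]
    refine (integrableOn_Ioi_rpow_mul_rpow_of_decay hV hpos hanti hs hq hdecay hγ).congr_fun
      (fun r hr => ?_) measurableSet_Ioi
    simp only [smul_eq_mul]
    rw [← hpow r hr]
    ring
  · have hgrad (x : EuclideanSpace ℝ (Fin n)) :
        u x ^ p * ‖x‖ ^ (-σ) * |⟪x, gradient u x⟫|
          = V ‖x‖ ^ p * ‖x‖ ^ (-σ) * |‖x‖ * deriv V ‖x‖| := by
      rw [← hu]
      rcases eq_or_ne x 0 with rfl | hx
      · simp
      · rw [inner_gradient_eq_norm_mul_deriv hu hx (hudiff x hx)]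
    simp only [hgrad]
    rw [integrable_fun_norm_addHaar volume
      (f := fun r => V r ^ p * r ^ (-σ) * |r * deriv V r|), finrank_euclideanSpace_fin]
    refine (integrableOn_Ioi_rpow_mul_rpow_mul_abs_deriv_of_decay hV hpos hanti hVdiff hs hq
      hdecay hγ).congr_fun (fun r hr => ?_) measurableSet_Ioi
    have hr0 : 0 < r := hr
    have hsplit : r ^ ((n : ℝ) - σ) = r ^ (n - σ - 1) * r := by
      rw [← Real.rpow_add_one hr0.ne', sub_add_cancel]
    simp only [smul_eq_mul]
    rw [hsplit, ← hpow r hr0, abs_mul, abs_of_pos hr0, add_sub_cancel_right]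
    ring
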